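/- arXiv:math/0608625 — 4 statements merged into one kernel-verified Lean document; each statement's English description precedes it below -/
import Mathlib

section
/- Let F be a field of characteristic different from 2, V a finite-dimensional F-vector space, and b, b' two nondegenerate bilinear forms on V with adjoint antiautomorphisms σ, ρ, asymmetries a, a', and twisted adjoints γ, γ' respectively. Suppose w ∈ End_F(V) is bijective and satisfies ρ(w ∘ f ∘ w⁻¹) = w ∘ σ(f) ∘ w⁻¹ for all f ∈ End_F(V). Then: (1) a' = w ∘ a ∘ w⁻¹; and (2) γ'(w ∘ f ∘ w⁻¹) = w ∘ γ(f) ∘ w⁻¹ for all f ∈ End_F(V). -/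
namespace LinearMap.BilinForm

variable {F V : Type*} [Field F] [AddCommGroup V] [Module F V]

theorem Nondegenerate.eq_of_forall_left {b : LinearMap.BilinForm F V} (hb : b.Nondegenerate)
    {u v : V} (h : ∀ x, b x u = b x v) : u = v :=
  sub_eq_zero.1 (hb.2 _ fun x => by rw [map_sub, h, sub_self])

/-- The adjoint of the rank-one endomorphism `x ↦ b x u • v` is `y ↦ b v y • u`. -/
theorem adjoint_rankOne {b : LinearMap.BilinForm F V} (hb : b.Nondegenerate)
    {σ : Module.End F V → Module.End F V} (hσ : ∀ x y f, b (f x) y = b x (σ f y)) (u v y : V) :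
    σ ((b.flip u).smulRight v) y = b v y • u :=
  hb.eq_of_forall_left fun x => by simp [← hσ, mul_comm]

/-- Two bilinear forms with the same adjoint, the first one nondegenerate, are proportional. -/
theorem mul_eq_mul_of_adjoint {b c : LinearMap.BilinForm F V} (hb : b.Nondegenerate)
    {σ : Module.End F V → Module.End F V} (hσ : ∀ x y f, b (f x) y = b x (σ f y))
    (hc : ∀ x y f, c (f x) y = c x (σ f y)) (x u v y : V) :
    b x u * c v y = b v y * c x u := by
  simpa [adjoint_rankOne hb hσ] using hc x y ((b.flip u).smulRight v)

/-- An asymmetry of a nondegenerate form is an asymmetry of every form with the same adjoint. -/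
theorem asymmetry_of_adjoint {b c : LinearMap.BilinForm F V} (hb : b.Nondegenerate)
    {σ : Module.End F V → Module.End F V} (hσ : ∀ x y f, b (f x) y = b x (σ f y))
    (hc : ∀ x y f, c (f x) y = c x (σ f y)) {a : V → V} (ha : ∀ x y, b x y = b y (a x))
    (x y : V) : c x y = c y (a x) := by
  by_cases h : ∃ s t, b s t ≠ 0
  · obtain ⟨s, t, hst⟩ := h
    refine mul_left_cancel₀ hst ?_
    rw [mul_eq_mul_of_adjoint hb hσ hc s t x y, mul_eq_mul_of_adjoint hb hσ hc s t y (a x), ha x y]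
  · push Not at h
    have hz : ∀ z : V, z = 0 := fun z => hb.2 z fun s => h s z
    simp [hz x, hz y]

/-- The twisted adjoint is the adjoint followed by composition with the asymmetry. -/
theorem twistedAdjoint_eq {b : LinearMap.BilinForm F V} (hb : b.Nondegenerate)
    {σ γ : Module.End F V → Module.End F V} (hσ : ∀ x y f, b (f x) y = b x (σ f y))
    (hγ : ∀ x y f, b x (f y) = b y (γ f x)) {a : Module.End F V}
    (ha : ∀ x y, b x y = b y (a x)) (f : Module.End F V) : γ f = σ f * a :=
  LinearMap.ext fun x => hb.eq_of_forall_left fun y => by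
    rw [← hγ, ha, hσ, Module.End.mul_apply]

end LinearMap.BilinForm

/-- Let `b, b'` be nondegenerate bilinear forms on a finite-dimensional
vector space `V` over a field of characteristic ≠ 2, with adjoint antiautomorphisms
`σ, ρ`, asymmetries `a, a'` and twisted adjoints `γ, γ'` respectively. If `w` is a
bijective endomorphism of `V` (with two-sided inverse `w'`) such that
`ρ(w f w⁻¹) = w σ(f) w⁻¹` for all `f`, then `a' = w a w⁻¹` and
`γ'(w f w⁻¹) = w γ(f) w⁻¹` for all `f`. -/
theorem clifford_stmt_7 (F V : Type*) [Field F] (hF : (2 : F) ≠ 0)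
    [AddCommGroup V] [Module F V] [FiniteDimensional F V]
    (b b' : LinearMap.BilinForm F V) (hb : b.Nondegenerate) (hb' : b'.Nondegenerate)
    (σ ρ γ γ' : Module.End F V →ₗ[F] Module.End F V)
    (hσ : ∀ (x y : V) (f : Module.End F V), b (f x) y = b x ((σ f) y))
    (hρ : ∀ (x y : V) (f : Module.End F V), b' (f x) y = b' x ((ρ f) y))
    (hγ : ∀ (x y : V) (f : Module.End F V), b x (f y) = b y ((γ f) x))
    (hγ' : ∀ (x y : V) (f : Module.End F V), b' x (f y) = b' y ((γ' f) x))
    (a a' : V →ₗ[F] V)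
    (ha : ∀ x y : V, b x y = b y (a x)) (ha' : ∀ x y : V, b' x y = b' y (a' x))
    (w w' : Module.End F V) (hww' : w * w' = 1 ∧ w' * w = 1)
    (hw : ∀ f : Module.End F V, ρ (w * f * w') = w * σ f * w') :
    a' = w * a * w' ∧ ∀ f : Module.End F V, γ' (w * f * w') = w * γ f * w' := by
  obtain ⟨h₁, h₂⟩ := hww'
  have hw₁ (x : V) : w (w' x) = x := LinearMap.congr_fun h₁ x
  have hw₂ (x : V) : w' (w x) = x := LinearMap.congr_fun h₂ x
  have hc (x y : V) (f : Module.End F V) :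
      b'.compl₁₂ w w (f x) y = b'.compl₁₂ w w x (σ f y) := by
    simpa [hw, hw₂] using hρ (w x) (w y) (w * f * w')
  have haw : a' = w * a * w' := LinearMap.ext fun x => hb'.eq_of_forall_left fun y => by
    rw [← ha']
    simpa [hw₁] using
      LinearMap.BilinForm.asymmetry_of_adjoint hb hσ hc ha (w' x) (w' y)
  refine ⟨haw, fun f => ?_⟩
  rw [LinearMap.BilinForm.twistedAdjoint_eq hb' hρ hγ' ha',
    LinearMap.BilinForm.twistedAdjoint_eq hb hσ hγ ha, hw, haw]
  simp only [mul_assoc]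
  rw [← mul_assoc w' w, h₂, one_mul]
end

section
/- Let F be a field of characteristic different from 2, V a finite-dimensional F-vector space, b a nondegenerate bilinear form on V with asymmetry a and twisted adjoint γ, and φ : V ⊗_F V → End_F(V) the linear map with φ(v ⊗ w)(x) = b(w, x)·v. Then: (1) the set of fixed points {f ∈ End_F(V) : γ(f) = f} equals the F-linear span of the maps φ(a(w) ⊗ w) for w ∈ V; and (2) for every w ∈ V, the trace of the endomorphism φ(a(w) ⊗ w) equals b(w, w). -/
open TensorProduct

/-- Let `b` be a nondegenerate bilinear form on a finite-dimensional
vector space `V` over a field of characteristic ≠ 2, `a` its asymmetry, `γ` its twisted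
adjoint and `φ : V ⊗ V → End_F(V)` the map with `φ(v ⊗ w)(x) = b(w, x)·v`. Then the
fixed points of `γ` are exactly the span of the endomorphisms `φ(a(w) ⊗ w)`, `w ∈ V`,
and the trace of `φ(a(w) ⊗ w)` equals `b(w, w)`. -/
theorem clifford_stmt_10 (F V : Type*) [Field F] (hF : (2 : F) ≠ 0)
    [AddCommGroup V] [Module F V] [FiniteDimensional F V]
    (b : LinearMap.BilinForm F V) (hb : b.Nondegenerate)
    (a : Module.End F V) (ha : ∀ x y : V, b x y = b y (a x))
    (γ : Module.End F V →ₗ[F] Module.End F V)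
    (hγ : ∀ (x y : V) (f : Module.End F V), b x (f y) = b y ((γ f) x))
    (φ : V ⊗[F] V →ₗ[F] Module.End F V)
    (hφ : ∀ v w x : V, φ (v ⊗ₜ[F] w) x = b w x • v) :
    {f : Module.End F V | γ f = f} =
        ↑(Submodule.span F {f : Module.End F V | ∃ w : V, f = φ (a w ⊗ₜ[F] w)}) ∧
      ∀ w : V, LinearMap.trace F V (φ (a w ⊗ₜ[F] w)) = b w w := by
  have inj : ∀ u v : V, (∀ y, b y u = b y v) → u = v := fun u v h =>
    sub_eq_zero.mp (hb.2 _ fun y => by rw [map_sub, h y, sub_self])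
  have a_surj : Function.Surjective a := by
    refine LinearMap.injective_iff_surjective.mp ((injective_iff_map_eq_zero a).mpr fun x hx => ?_)
    exact hb.1 x fun y => by rw [ha, hx, map_zero]
  have γ_swap (u w : V) : γ (φ (a u ⊗ₜ[F] w)) = φ (a w ⊗ₜ[F] u) := by
    ext x
    refine inj _ _ fun y => ?_
    rw [← hγ, hφ, hφ, map_smul, map_smul, ← ha, ← ha, smul_eq_mul, smul_eq_mul, mul_comm]
  set S := Submodule.span F {f : Module.End F V | ∃ w : V, f = φ (a w ⊗ₜ[F] w)}
  have diag_mem (w : V) : φ (a w ⊗ₜ[F] w) ∈ S := Submodule.subset_span ⟨w, rfl⟩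
  have add_γ_mem_of_tmul (v w : V) : φ (v ⊗ₜ[F] w) + γ (φ (v ⊗ₜ[F] w)) ∈ S := by
    obtain ⟨u, rfl⟩ := a_surj v
    have key : φ (a u ⊗ₜ[F] w) + γ (φ (a u ⊗ₜ[F] w)) =
        φ (a (u + w) ⊗ₜ[F] (u + w)) - φ (a u ⊗ₜ[F] u) - φ (a w ⊗ₜ[F] w) := by
      rw [γ_swap, map_add, add_tmul, tmul_add, tmul_add, map_add, map_add, map_add]
      abel
    rw [key]
    exact S.sub_mem (S.sub_mem (diag_mem _) (diag_mem _)) (diag_mem _)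
  have φ_surj (f : Module.End F V) : ∃ t, φ t = f := by
    let e := Module.finBasis F V
    refine ⟨∑ i, f (e i) ⊗ₜ[F] (b.toDual hb).symm (e.coord i), ?_⟩
    ext x
    simp only [map_sum, LinearMap.sum_apply, hφ, LinearMap.BilinForm.apply_toDual_symm_apply,
      Module.Basis.coord_apply]
    conv_rhs => rw [← e.sum_repr x, map_sum]
    simp
  have add_γ_mem (f : Module.End F V) : f + γ f ∈ S := by
    obtain ⟨t, rfl⟩ := φ_surj f
    induction t with
    | zero => simp
    | tmul v w => exact add_γ_mem_of_tmul v w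
    | add s t hs ht =>
      rw [map_add, map_add, add_add_add_comm]
      exact S.add_mem hs ht
  refine ⟨Set.Subset.antisymm (fun f hf => ?_) ?_, fun w => ?_⟩
  · have h := add_γ_mem f
    rw [show γ f = f from hf, ← two_smul F] at h
    exact (S.smul_mem_iff hF).mp h
  · change S ≤ LinearMap.eqLocus γ LinearMap.id
    refine Submodule.span_le.mpr ?_
    rintro _ ⟨w, rfl⟩
    exact γ_swap w w
  · have h : φ (a w ⊗ₜ[F] w) = (b w).smulRight (a w) := by
      ext x
      rw [hφ, LinearMap.smulRight_apply]
    rw [h, LinearMap.trace_smulRight, ← ha]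
end

section
/- Let F be a field of characteristic different from 2, V a finite-dimensional F-vector space of dimension n, and b a nondegenerate bilinear form on V with asymmetry a. Let C(V, b) be the quotient of the tensor algebra T(V) by the two-sided ideal generated by the elements a(v) ⊗ v − b(v, v)·1 for v ∈ V. Then C(V, b) is a finite-dimensional F-algebra of dimension at most 2^n. -/
/-- The relation on the tensor algebra `T(V)` identifying `a(v) ⊗ v` with the scalar
`b(v, v)`, for `v ∈ V`.  The quotient `RingQuot (cliffordRel F b a)` is the quotient
of `T(V)` by the two-sided ideal generated by the elements `a(v) ⊗ v − b(v, v)·1`,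
i.e. the Clifford algebra `C(V, b)` of the bilinear form `b` (with asymmetry `a`). -/
def cliffordRel (F : Type*) {V : Type*} [CommRing F] [AddCommGroup V] [Module F V]
    (b : LinearMap.BilinForm F V) (a : V →ₗ[F] V) :
    TensorAlgebra F V → TensorAlgebra F V → Prop := fun x y =>
  ∃ v : V, x = TensorAlgebra.ι F (a v) * TensorAlgebra.ι F v ∧
    y = algebraMap F (TensorAlgebra F V) (b v v)

namespace TwistedWord

variable {F V A : Type*} [Field F] [AddCommGroup V] [Module F V] [Ring A] [Algebra F A]

/-- Multiplication on the left by `j m`, after the automorphism `φ`. -/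
def twistedMul (j : V →ₗ[F] A) (φ : A ≃ₐ[F] A) : V →ₗ[F] A →ₗ[F] A :=
  (LinearMap.mul F A).compl₁₂ j φ.toLinearMap

@[simp]
lemma twistedMul_apply (j : V →ₗ[F] A) (φ : A ≃ₐ[F] A) (m : V) (x : A) :
    twistedMul j φ m x = j m * φ x := rfl

/-- The twisted word `j (v 0) * φ (j (v 1)) * φ² (j (v 2)) * ⋯` as a multilinear map in `v`. -/
def word (j : V →ₗ[F] A) (φ : A ≃ₐ[F] A) :
    (k : ℕ) → MultilinearMap F (fun _ : Fin k => V) A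
  | 0 => MultilinearMap.constOfIsEmpty F (fun _ : Fin 0 => V) 1
  | k + 1 => LinearMap.uncurryLeft (M := fun _ : Fin (k + 1) => V)
      { toFun := fun m => (twistedMul j φ m).compMultilinearMap (word j φ k)
        map_add' := fun x y => by ext; simp
        map_smul' := fun r x => by ext; simp }

variable (j : V →ₗ[F] A) (φ : A ≃ₐ[F] A)

@[simp]
lemma word_zero (v : Fin 0 → V) : word j φ 0 v = 1 := rfl

lemma word_succ (k : ℕ) (v : Fin (k + 1) → V) :
    word j φ (k + 1) v = j (v 0) * φ (word j φ k (Fin.tail v)) := rfl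

/-- The span of the twisted words of length less than `k`. -/
def shortWords (k : ℕ) : Submodule F A :=
  Submodule.span F {x | ∃ i < k, ∃ v : Fin i → V, x = word j φ i v}

variable {j φ}

lemma word_mem_shortWords {i k : ℕ} (h : i < k) (v : Fin i → V) :
    word j φ i v ∈ shortWords j φ k :=
  Submodule.subset_span ⟨i, h, v, rfl⟩

lemma shortWords_mono : Monotone (shortWords j φ) := fun _ _ h =>
  Submodule.span_mono fun _ ⟨i, hi, v, hv⟩ => ⟨i, hi.trans_le h, v, hv⟩

lemma shortWords_zero : shortWords j φ 0 = ⊥ := by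
  simp [shortWords]

lemma twistedMul_mem {k : ℕ} (m : V) {x : A} (hx : x ∈ shortWords j φ k) :
    j m * φ x ∈ shortWords j φ (k + 1) := by
  suffices shortWords j φ k ≤ (shortWords j φ (k + 1)).comap (twistedMul j φ m) from this hx
  refine Submodule.span_le.2 ?_
  rintro _ ⟨i, hi, v, rfl⟩
  have := word_mem_shortWords (j := j) (φ := φ) (Nat.succ_lt_succ hi) (Fin.cons m v)
  rwa [word_succ, Fin.cons_zero, Fin.tail_cons] at this

lemma map_word {ψ : A ≃ₐ[F] A} {d : V → V} (hψ : ∀ v, ψ (j v) = j (d v))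
    (hcomm : ∀ x, ψ (φ x) = φ (ψ x)) (k : ℕ) (v : Fin k → V) :
    ψ (word j φ k v) = word j φ k (d ∘ v) := by
  induction k with
  | zero => simp
  | succ k ih =>
    rw [word_succ, word_succ, map_mul, hψ, hcomm, ih]
    rfl

lemma map_mem {ψ : A ≃ₐ[F] A} {d : V → V} (hψ : ∀ v, ψ (j v) = j (d v))
    (hcomm : ∀ x, ψ (φ x) = φ (ψ x)) {k : ℕ} {x : A} (hx : x ∈ shortWords j φ k) :
    ψ x ∈ shortWords j φ k := by
  suffices shortWords j φ k ≤ (shortWords j φ k).comap ψ.toLinearMap from this hx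
  refine Submodule.span_le.2 ?_
  rintro _ ⟨i, hi, v, rfl⟩
  change ψ _ ∈ shortWords j φ k
  rw [map_word hψ hcomm]
  exact word_mem_shortWords hi _

variable {c : V ≃ₗ[F] V} {q : V → F}

lemma mul_add_mul_swap (hq : ∀ v, j v * j (c v) = algebraMap F A (q v)) (u v : V) :
    j u * j (c v) + j v * j (c u) = algebraMap F A (q (u + v) - q u - q v) := by
  rw [map_sub, map_sub, ← hq, ← hq, ← hq]
  simp only [map_add]
  noncomm_ring

lemma twistedMul_word_mem (hφ : ∀ v, φ (j v) = j (c v))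
    (hq : ∀ v, j v * j (c v) = algebraMap F A (q v)) (k : ℕ) (v : Fin k → V) (m : V)
    (hm : ∃ i, v i = m) : j m * φ (word j φ k v) ∈ shortWords j φ (k + 1) := by
  induction k with
  | zero => exact hm.choose.elim0
  | succ k ih =>
    have hsq : ∀ x ∈ shortWords j φ (k + 1), φ (φ x) ∈ shortWords j φ (k + 2) := fun x hx =>
      shortWords_mono (Nat.le_succ _) (map_mem hφ (fun _ => rfl) (map_mem hφ (fun _ => rfl) hx))
    have hw := hsq _ (word_mem_shortWords (Nat.lt_succ_self k) (Fin.tail v))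
    rw [word_succ, map_mul, hφ, ← mul_assoc]
    obtain ⟨i, rfl⟩ := hm
    cases i using Fin.cases with
    | zero =>
      rw [hq, ← Algebra.smul_def]
      exact Submodule.smul_mem _ _ hw
    | succ i =>
      rw [eq_sub_of_add_eq (mul_add_mul_swap hq (v i.succ) (v 0)), sub_mul, ← Algebra.smul_def]
      refine Submodule.sub_mem _ (Submodule.smul_mem _ _ hw) ?_
      have := twistedMul_mem (v 0) (ih (Fin.tail v) ⟨i, rfl⟩)
      rwa [map_mul, hφ, ← mul_assoc] at this

lemma word_mem_of_eq (hφ : ∀ v, φ (j v) = j (c v))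
    (hq : ∀ v, j v * j (c v) = algebraMap F A (q v)) (k : ℕ) (v : Fin k → V) (i l : Fin k)
    (hv : v i = v l) (hil : i ≠ l) : word j φ k v ∈ shortWords j φ k := by
  induction k with
  | zero => exact i.elim0
  | succ k ih =>
    rw [word_succ]
    cases i using Fin.cases with
    | zero =>
      cases l using Fin.cases with
      | zero => exact absurd rfl hil
      | succ l => exact twistedMul_word_mem hφ hq k _ _ ⟨l, hv.symm⟩
    | succ i =>
      cases l using Fin.cases with
      | zero => exact twistedMul_word_mem hφ hq k _ _ ⟨i, hv⟩
      | succ l =>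
        exact twistedMul_mem _ (ih (Fin.tail v) i l hv fun h => hil (congrArg Fin.succ h))

/-- Twisted words of length `k`, modulo shorter ones, as an alternating map. -/
def wordAlternating (hφ : ∀ v, φ (j v) = j (c v))
    (hq : ∀ v, j v * j (c v) = algebraMap F A (q v)) (k : ℕ) :
    V [⋀^Fin k]→ₗ[F] (A ⧸ shortWords j φ k) :=
  { (shortWords j φ k).mkQ.compMultilinearMap (word j φ k) with
    map_eq_zero_of_eq' := fun v i l hv hil =>
      (Submodule.Quotient.mk_eq_zero _).2 (word_mem_of_eq hφ hq k v i l hv hil) }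

variable [FiniteDimensional F V]

lemma exists_shortWords_succ_le (hφ : ∀ v, φ (j v) = j (c v))
    (hq : ∀ v, j v * j (c v) = algebraMap F A (q v)) (k : ℕ) :
    ∃ f : ⋀[F]^k V →ₗ[F] A,
      shortWords j φ (k + 1) ≤ shortWords j φ k ⊔ LinearMap.range f := by
  obtain ⟨f, hf⟩ := Module.projective_lifting_property (shortWords j φ k).mkQ
    (exteriorPower.alternatingMapLinearEquiv (wordAlternating hφ hq k))
    (Submodule.mkQ_surjective _)
  refine ⟨f, Submodule.span_le.2 ?_⟩
  rintro _ ⟨i, hi, v, rfl⟩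
  obtain hi | rfl := Nat.lt_succ_iff_lt_or_eq.1 hi
  · exact Submodule.mem_sup_left (word_mem_shortWords hi v)
  · have h : (shortWords j φ i).mkQ (f (exteriorPower.ιMulti F i v)) =
        (shortWords j φ i).mkQ (word j φ i v) := by
      rw [← LinearMap.comp_apply, hf, exteriorPower.alternatingMapLinearEquiv_apply_ιMulti]
      rfl
    have h' := (Submodule.Quotient.eq _).1 h.symm
    rw [← sub_add_cancel (word j φ i v) (f (exteriorPower.ιMulti F i v))]
    exact Submodule.add_mem_sup h' ⟨_, rfl⟩

lemma finiteDimensional_and_finrank_shortWords_le (hφ : ∀ v, φ (j v) = j (c v))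
    (hq : ∀ v, j v * j (c v) = algebraMap F A (q v)) (k : ℕ) :
    FiniteDimensional F (shortWords j φ k) ∧
      Module.finrank F (shortWords j φ k) ≤
        ∑ i ∈ Finset.range k, (Module.finrank F V).choose i := by
  induction k with
  | zero =>
    rw [shortWords_zero]
    exact ⟨inferInstance, by simp⟩
  | succ k ih =>
    obtain ⟨hfin, hle⟩ := ih
    obtain ⟨f, hf⟩ := exists_shortWords_succ_le hφ hq k
    refine ⟨Submodule.finiteDimensional_of_le hf, (Submodule.finrank_mono hf).trans
      ((Submodule.finrank_add_le_finrank_add_finrank _ _).trans ?_)⟩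
    rw [Finset.sum_range_succ, ← exteriorPower.finrank_eq F k (M := V)]
    exact add_le_add hle (LinearMap.finrank_range_le f)

lemma shortWords_succ_le (hφ : ∀ v, φ (j v) = j (c v))
    (hq : ∀ v, j v * j (c v) = algebraMap F A (q v)) {k : ℕ} (hk : Module.finrank F V < k) :
    shortWords j φ (k + 1) ≤ shortWords j φ k := by
  obtain ⟨f, hf⟩ := exists_shortWords_succ_le hφ hq k
  have : Subsingleton (⋀[F]^k V) := Module.finrank_zero_iff.1 <| by
    rw [exteriorPower.finrank_eq, Nat.choose_eq_zero_of_lt hk]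
  rwa [Subsingleton.elim f 0, LinearMap.range_zero, sup_bot_eq] at hf

lemma shortWords_eq_top (hφ : ∀ v, φ (j v) = j (c v))
    (hq : ∀ v, j v * j (c v) = algebraMap F A (q v))
    (hgen : Algebra.adjoin F (Set.range j) = ⊤) :
    shortWords j φ (Module.finrank F V + 1) = ⊤ := by
  set D := shortWords j φ (Module.finrank F V + 1) with hD
  have hsymm : ∀ v, φ.symm (j v) = j (c.symm v) := fun v => by
    rw [AlgEquiv.symm_apply_eq, hφ, c.apply_symm_apply]
  have hmul : ∀ y : A, ∀ x ∈ D, y * x ∈ D := fun y => by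
    have hy : y ∈ Algebra.adjoin F (Set.range j) := hgen ▸ Algebra.mem_top
    induction hy using Algebra.adjoin_induction with
    | mem y hy =>
      obtain ⟨m, rfl⟩ := hy
      intro x hx
      have := twistedMul_mem m (map_mem hsymm (fun x => by simp) hx)
      rw [φ.apply_symm_apply] at this
      exact shortWords_succ_le hφ hq (Nat.lt_succ_self _) this
    | algebraMap r =>
      intro x hx
      rw [← Algebra.smul_def]
      exact D.smul_mem r hx
    | add y z _ _ hy hz =>
      intro x hx
      rw [add_mul]
      exact D.add_mem (hy x hx) (hz x hx)
    | mul y z _ _ hy hz =>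
      intro x hx
      rw [mul_assoc]
      exact hy _ (hz x hx)
  refine Submodule.eq_top_iff'.2 fun y => ?_
  have h1 : (1 : A) ∈ D := word_mem_shortWords (j := j) (φ := φ) (Nat.succ_pos _) Fin.elim0
  simpa using hmul y 1 h1

theorem finiteDimensional_and_finrank_le (hφ : ∀ v, φ (j v) = j (c v))
    (hq : ∀ v, j v * j (c v) = algebraMap F A (q v))
    (hgen : Algebra.adjoin F (Set.range j) = ⊤) :
    FiniteDimensional F A ∧ Module.finrank F A ≤ 2 ^ Module.finrank F V := by
  have h := finiteDimensional_and_finrank_shortWords_le hφ hq (Module.finrank F V + 1)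
  rw [shortWords_eq_top hφ hq hgen, finrank_top, Nat.sum_range_choose] at h
  exact ⟨Module.finite_def.2 (Module.Finite.iff_fg.1 h.1), h.2⟩

end TwistedWord

namespace CliffordRel

variable {F V : Type*} [Field F] [AddCommGroup V] [Module F V]
  (b : LinearMap.BilinForm F V) (a : V →ₗ[F] V)

/-- The canonical map from `V` to the Clifford algebra of `b`. -/
def ι : V →ₗ[F] RingQuot (cliffordRel F b a) :=
  (RingQuot.mkAlgHom F (cliffordRel F b a)).toLinearMap ∘ₗ TensorAlgebra.ι F

lemma ι_mul_ι (v : V) :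
    ι b a (a v) * ι b a v = algebraMap F (RingQuot (cliffordRel F b a)) (b v v) := by
  have h := RingQuot.mkAlgHom_rel F (s := cliffordRel F b a) ⟨v, rfl, rfl⟩
  rwa [map_mul, AlgHom.commutes] at h

lemma adjoin_range_ι : Algebra.adjoin F (Set.range (ι b a)) = ⊤ := by
  have h : Set.range (ι b a) =
      RingQuot.mkAlgHom F (cliffordRel F b a) '' Set.range (TensorAlgebra.ι F) := by
    rw [← Set.range_comp]
    rfl
  rw [h, ← AlgHom.map_adjoin, TensorAlgebra.adjoin_range_ι, Algebra.map_top,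
    AlgHom.range_eq_top]
  exact RingQuot.mkAlgHom_surjective F _

variable {b a}

/-- The endomorphism of the Clifford algebra induced by a linear map commuting with the asymmetry
and preserving `b v v`. -/
def map (d : V →ₗ[F] V) (hda : ∀ v, d (a v) = a (d v)) (hdb : ∀ v, b (d v) (d v) = b v v) :
    RingQuot (cliffordRel F b a) →ₐ[F] RingQuot (cliffordRel F b a) :=
  RingQuot.liftAlgHom F ⟨TensorAlgebra.lift F (ι b a ∘ₗ d), by
    rintro _ _ ⟨v, rfl, rfl⟩
    rw [map_mul, TensorAlgebra.lift_ι_apply, TensorAlgebra.lift_ι_apply, AlgHom.commutes,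
      LinearMap.comp_apply, LinearMap.comp_apply, hda, ι_mul_ι, hdb]⟩

lemma map_ι (d : V →ₗ[F] V) (hda : ∀ v, d (a v) = a (d v)) (hdb : ∀ v, b (d v) (d v) = b v v)
    (v : V) : map d hda hdb (ι b a v) = ι b a (d v) := by
  simp [map, ι]

lemma algHom_ext {f g : RingQuot (cliffordRel F b a) →ₐ[F] RingQuot (cliffordRel F b a)}
    (h : ∀ v, f (ι b a v) = g (ι b a v)) : f = g :=
  AlgHom.ext_of_adjoin_eq_top (adjoin_range_ι b a) (by rintro _ ⟨v, rfl⟩; exact h v)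

end CliffordRel

/-- Let `b` be a nondegenerate bilinear form on an `n`-dimensional
vector space `V` over a field of characteristic ≠ 2, with asymmetry `a`. Then the
Clifford algebra `C(V, b) = T(V)/⟨a(v) ⊗ v − b(v,v)·1⟩` is finite-dimensional over
`F` of dimension at most `2 ^ n`. -/
theorem clifford_stmt_13 (F V : Type*) [Field F] (hF : (2 : F) ≠ 0)
    [AddCommGroup V] [Module F V] [FiniteDimensional F V]
    (b : LinearMap.BilinForm F V) (hb : b.Nondegenerate)
    (a : V →ₗ[F] V) (ha : ∀ x y : V, b x y = b y (a x)) :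
    FiniteDimensional F (RingQuot (cliffordRel F b a)) ∧
      Module.finrank F (RingQuot (cliffordRel F b a)) ≤ 2 ^ Module.finrank F V := by
  have hinj : Function.Injective a := (injective_iff_map_eq_zero a).2 fun v hv =>
    hb.1 v fun y => by rw [ha, hv, map_zero]
  have hab : ∀ v, b (a v) (a v) = b v v := fun v => by rw [← ha, ← ha]
  let e := LinearEquiv.ofInjectiveEndo a hinj
  have he : ∀ v, e v = a v := fun _ => rfl
  have hea : ∀ v, e.symm (a v) = a (e.symm v) := fun v => by
    rw [← he, ← he, e.symm_apply_apply, e.apply_symm_apply]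
  have heb : ∀ v, b (e.symm v) (e.symm v) = b v v := fun v => by
    rw [← hab, ← he, e.apply_symm_apply]
  let φ : RingQuot (cliffordRel F b a) ≃ₐ[F] RingQuot (cliffordRel F b a) :=
    AlgEquiv.ofAlgHom (CliffordRel.map e.symm.toLinearMap hea heb)
      (CliffordRel.map a (fun _ => rfl) hab)
      (CliffordRel.algHom_ext fun v => by
        simp [CliffordRel.map_ι, ← he])
      (CliffordRel.algHom_ext fun v => by
        simp [CliffordRel.map_ι, ← he])
  refine TwistedWord.finiteDimensional_and_finrank_le (j := CliffordRel.ι b a) (φ := φ)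
    (c := e.symm) (q := fun v => b v v) (CliffordRel.map_ι _ hea heb) (fun v => ?_)
    (CliffordRel.adjoin_range_ι b a)
  have h := CliffordRel.ι_mul_ι b a (e.symm v)
  rwa [← he, e.apply_symm_apply, heb] at h
end

section
/- Let F be a field of characteristic different from 2, V a finite-dimensional F-vector space, b a nondegenerate bilinear form on V with asymmetry a, and let C(V, b) = T(V)/⟨a(v) ⊗ v − b(v, v)·1 : v ∈ V⟩. Then for every field extension L of F, the L-algebra C(V ⊗_F L, b_L), where b_L is the L-bilinear extension of b, is isomorphic to C(V, b) ⊗_F L. -/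
open TensorProduct

section CliffordRel

variable {F V : Type*} [CommRing F] [AddCommGroup V] [Module F V]

/-- The canonical linear map from `V` to the Clifford algebra of a bilinear form. -/
noncomputable def cliffordRelι (b : LinearMap.BilinForm F V) (a : V →ₗ[F] V) :
    V →ₗ[F] RingQuot (cliffordRel F b a) :=
  (RingQuot.mkAlgHom F (cliffordRel F b a)).toLinearMap ∘ₗ TensorAlgebra.ι F

theorem cliffordRelι_mul_self (b : LinearMap.BilinForm F V) (a : V →ₗ[F] V) (v : V) :
    cliffordRelι b a (a v) * cliffordRelι b a v = algebraMap F _ (b v v) := by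
  have h := RingQuot.mkAlgHom_rel F
    (show cliffordRel F b a _ _ from ⟨v, rfl, rfl⟩)
  rwa [map_mul, AlgHom.commutes] at h

theorem cliffordRelι_mul_add_swap (b : LinearMap.BilinForm F V) (a : V →ₗ[F] V) (v w : V) :
    cliffordRelι b a (a v) * cliffordRelι b a w + cliffordRelι b a (a w) * cliffordRelι b a v =
      algebraMap F _ (b v w + b w v) := by
  have h := cliffordRelι_mul_self b a (v + w)
  simp only [map_add, LinearMap.add_apply, mul_add, add_mul, cliffordRelι_mul_self] at h
  rw [map_add, ← sub_eq_zero]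
  rw [← sub_eq_zero] at h
  rw [← h]
  abel

/-- The universal property of the Clifford algebra of a bilinear form. -/
noncomputable def cliffordRelLift {A : Type*} [Ring A] [Algebra F A]
    (b : LinearMap.BilinForm F V) (a : V →ₗ[F] V) (f : V →ₗ[F] A)
    (hf : ∀ v, f (a v) * f v = algebraMap F A (b v v)) :
    RingQuot (cliffordRel F b a) →ₐ[F] A :=
  RingQuot.liftAlgHom F ⟨TensorAlgebra.lift F f, by
    rintro _ _ ⟨v, rfl, rfl⟩
    simpa using hf v⟩

@[simp]
theorem cliffordRelLift_ι {A : Type*} [Ring A] [Algebra F A]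
    (b : LinearMap.BilinForm F V) (a : V →ₗ[F] V) (f : V →ₗ[F] A)
    (hf : ∀ v, f (a v) * f v = algebraMap F A (b v v)) (v : V) :
    cliffordRelLift b a f hf (cliffordRelι b a v) = f v := by
  simp [cliffordRelLift, cliffordRelι]

theorem cliffordRel_algHom_ext {A : Type*} [Ring A] [Algebra F A]
    {b : LinearMap.BilinForm F V} {a : V →ₗ[F] V}
    {f g : RingQuot (cliffordRel F b a) →ₐ[F] A}
    (h : ∀ v, f (cliffordRelι b a v) = g (cliffordRelι b a v)) : f = g := by
  refine RingQuot.ringQuot_ext' F f g (TensorAlgebra.hom_ext (LinearMap.ext h))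

variable {L : Type*} [CommRing L] [Algebra F L]

/-- The extension of scalars of the canonical map satisfies the Clifford relations of the
extended form. -/
theorem baseChange_cliffordRelι_mul_self (b : LinearMap.BilinForm F V) (a : V →ₗ[F] V)
    (bL : LinearMap.BilinForm L (L ⊗[F] V))
    (hbL : ∀ (l l' : L) (v v' : V),
      bL (l ⊗ₜ[F] v) (l' ⊗ₜ[F] v') = l * l' * algebraMap F L (b v v'))
    (aL : (L ⊗[F] V) →ₗ[L] (L ⊗[F] V))
    (haL : ∀ (l : L) (v : V), aL (l ⊗ₜ[F] v) = l ⊗ₜ[F] (a v)) (x : L ⊗[F] V) :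
    (cliffordRelι b a).baseChange L (aL x) * (cliffordRelι b a).baseChange L x =
      algebraMap L (L ⊗[F] RingQuot (cliffordRel F b a)) (bL x x) := by
  have scalar (l : L) (r : F) : l ⊗ₜ[F] algebraMap F (RingQuot (cliffordRel F b a)) r =
      (l * algebraMap F L r) ⊗ₜ[F] 1 := by
    rw [Algebra.algebraMap_eq_smul_one, ← TensorProduct.smul_tmul, Algebra.smul_def, mul_comm]
  have swap (x y : L ⊗[F] V) :
      (cliffordRelι b a).baseChange L (aL x) * (cliffordRelι b a).baseChange L y +
        (cliffordRelι b a).baseChange L (aL y) * (cliffordRelι b a).baseChange L x =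
      algebraMap L (L ⊗[F] RingQuot (cliffordRel F b a)) (bL x y + bL y x) := by
    induction x with
    | zero => simp
    | add x₁ x₂ h₁ h₂ =>
      simp only [map_add, LinearMap.add_apply, mul_add, add_mul] at h₁ h₂ ⊢
      rw [add_add_add_comm, h₁, h₂, add_add_add_comm]
    | tmul l v =>
      induction y with
      | zero => simp
      | add y₁ y₂ h₁ h₂ =>
        simp only [map_add, LinearMap.add_apply, mul_add, add_mul] at h₁ h₂ ⊢
        rw [add_add_add_comm, h₁, h₂, add_add_add_comm]
      | tmul m w =>
        simp only [haL, hbL, LinearMap.baseChange_tmul, Algebra.TensorProduct.tmul_mul_tmul,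
          Algebra.TensorProduct.algebraMap_apply, Algebra.algebraMap_self, RingHom.id_apply]
        rw [mul_comm m l, ← TensorProduct.tmul_add, cliffordRelι_mul_add_swap, scalar,
          map_add, mul_add]
  induction x with
  | zero => simp
  | tmul l v =>
    simp only [haL, hbL, LinearMap.baseChange_tmul, Algebra.TensorProduct.tmul_mul_tmul,
      Algebra.TensorProduct.algebraMap_apply, Algebra.algebraMap_self, RingHom.id_apply,
      cliffordRelι_mul_self, scalar]
  | add x y hx hy =>
    have h := swap x y
    simp only [map_add, LinearMap.add_apply, mul_add, add_mul, hx, hy] at h ⊢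
    rw [← sub_eq_zero] at h ⊢
    rw [← h]
    abel

/-- The Clifford algebra of the extended form is the extension of scalars of the Clifford
algebra. -/
noncomputable def cliffordRelEquivBaseChange (b : LinearMap.BilinForm F V) (a : V →ₗ[F] V)
    (bL : LinearMap.BilinForm L (L ⊗[F] V))
    (hbL : ∀ (l l' : L) (v v' : V),
      bL (l ⊗ₜ[F] v) (l' ⊗ₜ[F] v') = l * l' * algebraMap F L (b v v'))
    (aL : (L ⊗[F] V) →ₗ[L] (L ⊗[F] V))
    (haL : ∀ (l : L) (v : V), aL (l ⊗ₜ[F] v) = l ⊗ₜ[F] (a v)) :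
    RingQuot (cliffordRel L bL aL) ≃ₐ[L] L ⊗[F] RingQuot (cliffordRel F b a) :=
  let φ := cliffordRelLift bL aL ((cliffordRelι b a).baseChange L)
    (baseChange_cliffordRelι_mul_self b a bL hbL aL haL)
  let f : V →ₗ[F] RingQuot (cliffordRel L bL aL) :=
    (cliffordRelι bL aL).restrictScalars F ∘ₗ TensorProduct.mk F L V 1
  let ψ₀ := cliffordRelLift b a f fun v => by
    have h := cliffordRelι_mul_self bL aL (1 ⊗ₜ[F] v)
    rw [haL, hbL, one_mul, one_mul, ← IsScalarTower.algebraMap_apply] at h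
    exact h
  let ψ : L ⊗[F] RingQuot (cliffordRel F b a) →ₐ[L] RingQuot (cliffordRel L bL aL) :=
    Algebra.TensorProduct.lift (Algebra.ofId L _) ψ₀ fun _ _ => Algebra.commutes _ _
  have hψ (v : V) : ψ (1 ⊗ₜ[F] cliffordRelι b a v) = cliffordRelι bL aL (1 ⊗ₜ[F] v) := by
    refine (Algebra.TensorProduct.lift_tmul _ _ _ _ _).trans ?_
    rw [map_one, one_mul]
    exact cliffordRelLift_ι _ _ _ _ _
  AlgEquiv.ofAlgHom φ ψ
    (by
      refine Algebra.TensorProduct.ext (Subsingleton.elim _ _)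
        (cliffordRel_algHom_ext fun v => ?_)
      change φ (ψ (1 ⊗ₜ[F] cliffordRelι b a v)) = 1 ⊗ₜ[F] cliffordRelι b a v
      rw [hψ, cliffordRelLift_ι, LinearMap.baseChange_tmul])
    (by
      refine cliffordRel_algHom_ext fun x => ?_
      suffices (ψ.toLinearMap ∘ₗ (cliffordRelι b a).baseChange L) = cliffordRelι bL aL by
        simpa [φ] using LinearMap.congr_fun this x
      ext v
      simpa using hψ v)

end CliffordRel

/-- Let `b` be a nondegenerate bilinear form on a finite-dimensional
vector space `V` over a field `F` of characteristic ≠ 2, with asymmetry `a`, and let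
`L/F` be a field extension.  Let `b_L` be the `L`-bilinear extension of `b` to
`L ⊗_F V` (so `b_L(l ⊗ v, l' ⊗ v') = l l' b(v, v')`), whose asymmetry is
`a_L = id_L ⊗ a`.  Then `C(V ⊗ L, b_L) ≅ C(V, b) ⊗_F L` as `L`-algebras. -/
theorem clifford_stmt_14 (F V L : Type*) [Field F] (hF : (2 : F) ≠ 0)
    [AddCommGroup V] [Module F V] [FiniteDimensional F V]
    [Field L] [Algebra F L]
    (b : LinearMap.BilinForm F V) (hb : b.Nondegenerate)
    (a : V →ₗ[F] V) (ha : ∀ x y : V, b x y = b y (a x))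
    (bL : LinearMap.BilinForm L (L ⊗[F] V))
    (hbL : ∀ (l l' : L) (v v' : V),
      bL (l ⊗ₜ[F] v) (l' ⊗ₜ[F] v') = l * l' * algebraMap F L (b v v'))
    (aL : (L ⊗[F] V) →ₗ[L] (L ⊗[F] V))
    (haL : ∀ (l : L) (v : V), aL (l ⊗ₜ[F] v) = l ⊗ₜ[F] (a v)) :
    Nonempty (RingQuot (cliffordRel L bL aL) ≃ₐ[L]
      (L ⊗[F] RingQuot (cliffordRel F b a))) := by
  exact ⟨cliffordRelEquivBaseChange b a bL hbL aL haL⟩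
end
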